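/- Expected numbers in the branching random walk satisfy a large-deviation limit with at most one exceptional point: there exists a₀ ∈ ℝ such that for every a ∈ ℝ with a ≠ a₀, (1/n) log μ^{*n}([na, ∞)) converges to −κ*(a) as n → ∞, in the extended reals (with log 0 = −∞). -/

import Mathlib

open MeasureTheory Filter Topology

/-- The log-Laplace transform of the intensity measure `μ`:
`κ(θ) = log ∫ e^{θ z} μ(dz)` for `θ ≥ 0`, and `κ(θ) = ∞` for `θ < 0`. -/
noncomputable def kappa (μ : Measure ℝ) (θ : ℝ) : EReal :=
  if 0 ≤ θ then (∫⁻ z, ENNReal.ofReal (Real.exp (θ * z)) ∂μ).log else ⊤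

/-- The Fenchel dual `κ*(a) = sup_{θ ∈ ℝ} (θ a − κ(θ))`. -/
noncomputable def kappaStar (μ : Measure ℝ) (a : ℝ) : EReal :=
  ⨆ θ : ℝ, ((θ * a : ℝ) : EReal) - kappa μ θ

/-- The `n`-fold convolution power of a measure on `ℝ` (`μ^{*0}` is the Dirac
mass at `0`, and `μ^{*1} = μ`). -/
noncomputable def convPow (μ : Measure ℝ) : ℕ → Measure ℝ
  | 0 => Measure.dirac 0
  | n + 1 => Measure.conv (convPow μ n) μ

open Set

instance isFiniteMeasure_convPow (μ : Measure ℝ) [IsFiniteMeasure μ] (n : ℕ) :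
    IsFiniteMeasure (convPow μ n) := by
  induction n with
  | zero => unfold convPow; infer_instance
  | succ n ih => unfold convPow; infer_instance

lemma convPow_one (μ : Measure ℝ) [IsFiniteMeasure μ] : convPow μ 1 = μ := by
  simp [convPow]

lemma convPow_add (μ : Measure ℝ) [IsFiniteMeasure μ] (m n : ℕ) :
    convPow μ (m + n) = (convPow μ m).conv (convPow μ n) := by
  induction n with
  | zero => simp [convPow]
  | succ n ih => rw [← add_assoc, convPow, ih, convPow, Measure.conv_assoc]

/-- A pointwise bound `f x * g y ≤ h (x + y)` passes to integrals against a convolution. -/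
lemma lintegral_mul_lintegral_le_lintegral_conv {μ ν : Measure ℝ} [SFinite μ] [SFinite ν]
    {f g h : ℝ → ENNReal} (hf : Measurable f) (hg : Measurable g) (hh : Measurable h)
    (hfgh : ∀ x y, f x * g y ≤ h (x + y)) :
    (∫⁻ x, f x ∂μ) * ∫⁻ y, g y ∂ν ≤ ∫⁻ z, h z ∂(μ.conv ν) := by
  rw [Measure.conv, lintegral_map hh (by fun_prop),
    ← lintegral_prod_mul hf.aemeasurable hg.aemeasurable]
  exact lintegral_mono fun z => hfgh z.1 z.2

lemma ofReal_exp_mul_add (θ x y : ℝ) : ENNReal.ofReal (Real.exp (θ * (x + y))) =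
    ENNReal.ofReal (Real.exp (θ * x)) * ENNReal.ofReal (Real.exp (θ * y)) := by
  rw [← ENNReal.ofReal_mul (Real.exp_pos _).le, ← Real.exp_add, mul_add]

lemma lintegral_exp_convPow (μ : Measure ℝ) [IsFiniteMeasure μ] (θ : ℝ) (n : ℕ) :
    ∫⁻ z, ENNReal.ofReal (Real.exp (θ * z)) ∂(convPow μ n) =
      (∫⁻ z, ENNReal.ofReal (Real.exp (θ * z)) ∂μ) ^ n := by
  induction n with
  | zero => simp [convPow]
  | succ n ih =>
    rw [convPow, Measure.conv, lintegral_map (by fun_prop) (by fun_prop), pow_succ, ← ih]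
    simp_rw [ofReal_exp_mul_add]
    exact lintegral_prod_mul (f := fun z => ENNReal.ofReal (Real.exp (θ * z)))
      (g := fun z => ENNReal.ofReal (Real.exp (θ * z))) (by fun_prop) (by fun_prop)

lemma convPow_univ (μ : Measure ℝ) [IsFiniteMeasure μ] (n : ℕ) :
    convPow μ n univ = μ univ ^ n := by
  simpa using lintegral_exp_convPow μ 0 n

/-- The Chernoff bound for convolution powers. -/
lemma exp_mul_convPow_Ici_le (μ : Measure ℝ) [IsFiniteMeasure μ] {θ : ℝ} (hθ : 0 ≤ θ)
    (n : ℕ) (y : ℝ) :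
    ENNReal.ofReal (Real.exp (θ * y)) * convPow μ n (Ici y) ≤
      (∫⁻ z, ENNReal.ofReal (Real.exp (θ * z)) ∂μ) ^ n := by
  rw [← lintegral_exp_convPow]
  refine (mul_le_mul_right (measure_mono fun z hz => ?_) _).trans
    (mul_meas_ge_le_lintegral (by fun_prop) _)
  exact ENNReal.ofReal_le_ofReal
    (Real.exp_le_exp.2 (mul_le_mul_of_nonneg_left (mem_Ici.1 hz) hθ))

lemma convPow_Ici_mul_le (μ : Measure ℝ) [IsFiniteMeasure μ] {m n : ℕ} {x y z : ℝ}
    (h : z ≤ x + y) :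
    convPow μ m (Ici x) * convPow μ n (Ici y) ≤ convPow μ (m + n) (Ici z) := by
  rw [convPow_add]
  simpa [lintegral_indicator_one measurableSet_Ici] using
    lintegral_mul_lintegral_le_lintegral_conv (μ := convPow μ m) (ν := convPow μ n)
      (f := (Ici x).indicator 1) (g := (Ici y).indicator 1) (h := (Ici z).indicator 1)
      (measurable_one.indicator measurableSet_Ici) (measurable_one.indicator measurableSet_Ici)
      (measurable_one.indicator measurableSet_Ici) (fun s t => by
        by_cases hs : x ≤ s <;> by_cases ht : y ≤ t <;> simp [hs, ht, indicator]
        rw [if_pos (by linarith)])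

/-- If one summand almost surely stays below `b`, then so does the average of `n ≥ 1` summands. -/
lemma convPow_Ici_eq_zero {μ : Measure ℝ} [IsFiniteMeasure μ] {b : ℝ} (hb : μ (Ici b) = 0)
    {n : ℕ} (hn : n ≠ 0) : convPow μ n (Ici (n * b)) = 0 := by
  induction n, Nat.one_le_iff_ne_zero.2 hn using Nat.le_induction with
  | base => simpa [convPow_one] using hb
  | succ n hn ih =>
    rw [convPow, Measure.conv, Measure.map_apply (by fun_prop) measurableSet_Ici]
    refine measure_mono_null (t := (Ici (n * b) ×ˢ univ) ∪ (univ ×ˢ Ici b)) ?_ ?_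
    · rintro ⟨x, y⟩ hxy
      by_contra! hc
      simp only [mem_union, mem_prod, mem_Ici, mem_univ, and_true, true_and, not_or, not_le] at hc
      simp only [mem_preimage, mem_Ici] at hxy
      push_cast at hxy
      linarith [hc.1, hc.2]
    · refine measure_union_null ?_ ?_
      · rw [Measure.prod_prod, ih (by omega), zero_mul]
      · rw [Measure.prod_prod, hb, mul_zero]

lemma convPow_Ici_ne_zero {μ : Measure ℝ} [IsFiniteMeasure μ] {b : ℝ} (hb : μ (Ici b) ≠ 0)
    (n : ℕ) : convPow μ n (Ici (n * b)) ≠ 0 := by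
  induction n with
  | zero => simp [convPow]
  | succ n ih =>
    have h := convPow_Ici_mul_le μ (m := n) (n := 1) (x := n * b) (y := b)
      (z := (n + 1 : ℕ) * b) (by push_cast; linarith)
    rw [convPow_one] at h
    exact ((pos_iff_ne_zero.2 (mul_ne_zero ih hb)).trans_le h).ne'

/-- The exponential integral over `[-K, K]` is submultiplicative under convolution. -/
lemma setLIntegral_exp_pow_le (μ : Measure ℝ) [IsFiniteMeasure μ] (θ : ℝ) (K n : ℕ) :
    (∫⁻ z in Icc (-K : ℝ) K, ENNReal.ofReal (Real.exp (θ * z)) ∂μ) ^ n ≤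
      ∫⁻ z in Icc (-(n * K : ℕ) : ℝ) (n * K : ℕ), ENNReal.ofReal (Real.exp (θ * z))
        ∂(convPow μ n) := by
  induction n with
  | zero => simp [convPow]
  | succ n ih =>
    rw [pow_succ, convPow]
    refine (mul_le_mul_left ih _).trans ?_
    simp_rw [← lintegral_indicator measurableSet_Icc]
    refine lintegral_mul_lintegral_le_lintegral_conv
      (Measurable.indicator (by fun_prop) measurableSet_Icc)
      (Measurable.indicator (by fun_prop) measurableSet_Icc)
      (Measurable.indicator (by fun_prop) measurableSet_Icc) fun x y => ?_
    by_cases hx : x ∈ Icc (-(n * K : ℕ) : ℝ) (n * K : ℕ)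
    · by_cases hy : y ∈ Icc (-K : ℝ) K
      · have hxy : x + y ∈ Icc (-((n + 1) * K : ℕ) : ℝ) ((n + 1) * K : ℕ) := by
          simp only [mem_Icc] at *
          push_cast at *
          constructor <;> linarith
        rw [indicator_of_mem hx, indicator_of_mem hy, indicator_of_mem hxy, ofReal_exp_mul_add]
      · rw [indicator_of_notMem hy, mul_zero]
        exact zero_le
    · rw [indicator_of_notMem hx, zero_mul]
      exact zero_le

lemma setLIntegral_exp_le_of_tail_le (ν : Measure ℝ) {θ : ℝ} (hθ : 0 ≤ θ) {A : ENNReal}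
    (hA : ∀ y, ν (Ici y) ≤ A * ENNReal.ofReal (Real.exp (-(θ * y)))) (N : ℕ) :
    ∫⁻ z in Icc (-N : ℝ) N, ENNReal.ofReal (Real.exp (θ * z)) ∂ν ≤
      (2 * N + 1 : ℕ) * (A * ENNReal.ofReal (Real.exp θ)) := by
  rw [← lintegral_indicator measurableSet_Icc]
  have hpt : ∀ z : ℝ, (Icc (-N : ℝ) N).indicator
      (fun z => ENNReal.ofReal (Real.exp (θ * z))) z ≤
      ∑ k ∈ Finset.Icc (-N : ℤ) N, (Ici (k : ℝ)).indicator
        (fun _ => ENNReal.ofReal (Real.exp (θ * (k + 1)))) z := by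
    intro z
    by_cases hz : z ∈ Icc (-N : ℝ) N
    · have hk : ⌊z⌋ ∈ Finset.Icc (-N : ℤ) N := by
        rw [Finset.mem_Icc]
        refine ⟨Int.le_floor.2 (by push_cast; exact hz.1), ?_⟩
        exact_mod_cast (Int.floor_le z).trans hz.2
      refine le_trans ?_ (Finset.single_le_sum (fun _ _ => zero_le) hk)
      rw [indicator_of_mem hz, indicator_of_mem (mem_Ici.2 (Int.floor_le z))]
      exact ENNReal.ofReal_le_ofReal (Real.exp_le_exp.2
        (mul_le_mul_of_nonneg_left (Int.lt_floor_add_one z).le hθ))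
    · simp [indicator_of_notMem hz]
  refine (lintegral_mono hpt).trans ?_
  rw [lintegral_finsetSum _ fun k _ => measurable_const.indicator measurableSet_Ici]
  have hterm : ∀ k ∈ Finset.Icc (-N : ℤ) N, ∫⁻ z, (Ici (k : ℝ)).indicator
      (fun _ => ENNReal.ofReal (Real.exp (θ * (k + 1)))) z ∂ν ≤
      A * ENNReal.ofReal (Real.exp θ) := by
    intro k _
    rw [lintegral_indicator_const measurableSet_Ici]
    refine (mul_le_mul_right (hA k) _).trans_eq ?_
    rw [mul_left_comm, ← ENNReal.ofReal_mul (Real.exp_pos _).le, ← Real.exp_add]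
    ring_nf
  refine (Finset.sum_le_card_nsmul _ _ _ hterm).trans_eq ?_
  rw [nsmul_eq_mul, Int.card_Icc]
  congr 3
  omega

lemma le_of_forall_pow_le_mul_pow {M C B : ℝ} (hC : 0 < C) (K : ℕ)
    (h : ∀ n : ℕ, n ≠ 0 → M ^ n ≤ (2 * (n * K : ℕ) + 1 : ℕ) * (C ^ n * B)) : M ≤ C := by
  by_contra! hlt
  have hr : 1 < M / C := (one_lt_div hC).2 hlt
  have h0 := ((tendsto_pow_const_div_const_pow_of_one_lt 1 hr).const_mul (2 * K * B)).add
    ((tendsto_pow_const_div_const_pow_of_one_lt 0 hr).const_mul B)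
  simp only [mul_zero, add_zero] at h0
  obtain ⟨n, hn, hn0⟩ := ((h0.eventually_lt_const one_pos).and (eventually_ne_atTop 0)).exists
  have hpos : 0 < (M / C) ^ n := pow_pos (one_pos.trans hr) n
  have hCn : 0 < C ^ n := pow_pos hC n
  have hle : (M / C) ^ n ≤ (2 * (n * K) + 1) * B := by
    rw [div_pow, div_le_iff₀ hCn]
    have := h n hn0
    push_cast at this
    linarith
  have : 2 * K * B * ((n : ℝ) ^ 1 / (M / C) ^ n) + B * ((n : ℝ) ^ 0 / (M / C) ^ n) =
      (2 * (n * K) + 1) * B / (M / C) ^ n := by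
    field_simp
  rw [this, div_lt_one hpos] at hn
  linarith

/-- A converse to the Chernoff bound: exponential tail bounds on all convolution powers control
the Laplace transform. -/
lemma lintegral_exp_le_of_convPow_tail_le (μ : Measure ℝ) [IsFiniteMeasure μ] {θ C : ℝ}
    (hθ : 0 ≤ θ) (hC : 0 < C)
    (h : ∀ n : ℕ, n ≠ 0 → ∀ y, convPow μ n (Ici y) ≤
      ENNReal.ofReal (C ^ n) * ENNReal.ofReal (Real.exp (-(θ * y)))) :
    ∫⁻ z, ENNReal.ofReal (Real.exp (θ * z)) ∂μ ≤ ENNReal.ofReal C := by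
  have hmono : Monotone fun K : ℕ => Icc (-K : ℝ) K := fun i j hij =>
    Icc_subset_Icc (by simpa using hij) (by simpa using hij)
  have huniv : ⋃ K : ℕ, Icc (-K : ℝ) K = univ := by
    refine eq_univ_of_forall fun z => ?_
    obtain ⟨K, hK⟩ := exists_nat_ge |z|
    exact mem_iUnion.2 ⟨K, abs_le.1 hK⟩
  rw [← setLIntegral_univ, ← huniv, setLIntegral_iUnion_of_directed _ hmono.directed_le]
  refine iSup_le fun K => ?_
  set M := ∫⁻ z in Icc (-K : ℝ) K, ENNReal.ofReal (Real.exp (θ * z)) ∂μ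
  have hpow : ∀ n : ℕ, n ≠ 0 → M ^ n ≤ ENNReal.ofReal
      ((2 * (n * K : ℕ) + 1 : ℕ) * (C ^ n * Real.exp θ)) := by
    intro n hn
    refine (setLIntegral_exp_pow_le μ θ K n).trans
      ((setLIntegral_exp_le_of_tail_le _ hθ (h n hn) _).trans_eq ?_)
    rw [ENNReal.ofReal_mul (Nat.cast_nonneg _), ENNReal.ofReal_natCast,
      ENNReal.ofReal_mul (pow_pos hC n).le]
  have hMtop : M ≠ ⊤ := ne_top_of_le_ne_top ENNReal.ofReal_ne_top (by simpa using hpow 1 one_ne_zero)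
  rw [ENNReal.le_ofReal_iff_toReal_le hMtop hC.le]
  refine le_of_forall_pow_le_mul_pow (B := Real.exp θ) hC K fun n hn => ?_
  rw [← ENNReal.toReal_pow]
  exact ENNReal.toReal_le_of_le_ofReal (by positivity) (hpow n hn)

/-- `(1/n) log μ^{*n}[n b, ∞)` converges to its supremum as soon as `μ [b, ∞) ≠ 0`. -/
lemma exists_tendsto_neg_log_convPow_div {μ : Measure ℝ} [IsFiniteMeasure μ] {b : ℝ}
    (hb : μ (Ici b) ≠ 0) :
    ∃ L : ℝ, Tendsto (fun n : ℕ => -Real.log ((convPow μ n).real (Ici (n * b))) / n)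
      atTop (𝓝 L) ∧
      ∀ n : ℕ, n ≠ 0 → L ≤ -Real.log ((convPow μ n).real (Ici (n * b))) / n := by
  have hpos : ∀ n : ℕ, 0 < (convPow μ n).real (Ici (n * b)) := fun n =>
    ENNReal.toReal_pos (convPow_Ici_ne_zero hb n) (measure_ne_top _ _)
  have hsub : Subadditive fun n : ℕ => -Real.log ((convPow μ n).real (Ici (n * b))) := by
    intro m n
    rw [← neg_add, ← Real.log_mul (hpos m).ne' (hpos n).ne']
    refine neg_le_neg (Real.log_le_log (mul_pos (hpos m) (hpos n)) ?_)
    rw [Measure.real, Measure.real, ← ENNReal.toReal_mul]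
    refine ENNReal.toReal_mono (measure_ne_top _ _) (convPow_Ici_mul_le μ ?_)
    push_cast
    linarith
  have hbdd : BddBelow (range fun n : ℕ =>
      -Real.log ((convPow μ n).real (Ici (n * b))) / n) := by
    refine ⟨-|Real.log (μ.real univ)|, ?_⟩
    rintro _ ⟨n, rfl⟩
    rcases eq_or_ne n 0 with rfl | hn
    · simp
    · have hn' : (0 : ℝ) < n := by positivity
      rw [le_div_iff₀ hn', neg_mul, neg_le_neg_iff]
      calc Real.log ((convPow μ n).real (Ici (n * b))) ≤ Real.log (μ.real univ ^ n) := by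
            refine Real.log_le_log (hpos n) ?_
            rw [Measure.real, Measure.real, ← ENNReal.toReal_pow, ← convPow_univ]
            exact ENNReal.toReal_mono (measure_ne_top _ _) (measure_mono (subset_univ _))
        _ = Real.log (μ.real univ) * n := by rw [Real.log_pow, mul_comm]
        _ ≤ |Real.log (μ.real univ)| * n :=
            mul_le_mul_of_nonneg_right (le_abs_self _) hn'.le
  exact ⟨hsub.lim, hsub.tendsto_lim hbdd, fun n hn => hsub.lim_le_div hbdd hn⟩

lemma isLowerSet_Ici_ne_zero (μ : Measure ℝ) : IsLowerSet {b : ℝ | μ (Ici b) ≠ 0} :=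
  fun _ _ hcb hb h => hb (measure_mono_null (Ici_subset_Ici.2 hcb) h)

/-- The exponential decay rate of the upper tails is a convex function of the level. -/
lemma convexOn_rate {μ : Measure ℝ} [IsFiniteMeasure μ] {L : ℝ → ℝ}
    (hL : ∀ b, μ (Ici b) ≠ 0 →
      Tendsto (fun n : ℕ => -Real.log ((convPow μ n).real (Ici (n * b))) / n)
        atTop (𝓝 (L b))) :
    ConvexOn ℝ {b : ℝ | μ (Ici b) ≠ 0} L := by
  have hconv : Convex ℝ {b : ℝ | μ (Ici b) ≠ 0} :=
    (isLowerSet_Ici_ne_zero μ).ordConnected.convex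
  refine LinearOrder.convexOn_of_lt hconv fun x hx y hy hxy s t hs ht hst => ?_
  simp only [smul_eq_mul]
  set z := s * x + t * y with hz
  have hzD : μ (Ici z) ≠ 0 := hconv hx hy hs.le ht.le hst
  let p : ℕ → ℕ := fun n => ⌊s * n⌋₊
  let q : ℕ → ℕ := fun n => n - p n
  have hple : ∀ n, (p n : ℝ) ≤ s * n := fun n => Nat.floor_le (by positivity)
  have hpn : ∀ n, p n ≤ n := fun n => by
    have : (p n : ℝ) ≤ n := (hple n).trans
      (mul_le_of_le_one_left (Nat.cast_nonneg n) (by linarith))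
    exact_mod_cast this
  have hq : ∀ n, (q n : ℝ) = n - p n := fun n => Nat.cast_sub (hpn n)
  have hp_top : Tendsto p atTop atTop := tendsto_nat_floor_mul_atTop s hs
  have hq_top : Tendsto q atTop atTop := by
    rw [← tendsto_natCast_atTop_iff (R := ℝ)]
    refine tendsto_atTop_mono (fun n => ?_) (tendsto_natCast_atTop_atTop.const_mul_atTop ht)
    rw [hq, show t = 1 - s by linarith]
    linarith [hple n]
  have hp_div : Tendsto (fun n : ℕ => (p n : ℝ) / n) atTop (𝓝 s) :=
    (tendsto_nat_floor_mul_div_atTop hs.le).comp tendsto_natCast_atTop_atTop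
  have hq_div : Tendsto (fun n : ℕ => (q n : ℝ) / n) atTop (𝓝 t) := by
    rw [show t = 1 - s by linarith]
    refine (tendsto_const_nhds.sub hp_div).congr' ?_
    filter_upwards [eventually_ne_atTop 0] with n hn
    have hn' : (n : ℝ) ≠ 0 := Nat.cast_ne_zero.2 hn
    rw [hq, sub_div, div_self hn']
  refine le_of_tendsto_of_tendsto (hL z hzD)
    ((hp_div.mul ((hL x hx).comp hp_top)).add (hq_div.mul ((hL y hy).comp hq_top))) ?_
  filter_upwards [hp_top.eventually_gt_atTop 0, hq_top.eventually_gt_atTop 0,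
    eventually_gt_atTop 0] with n hp0 hq0 hn0
  have hpos : ∀ (n : ℕ) {b : ℝ}, μ (Ici b) ≠ 0 → 0 < (convPow μ n).real (Ici (n * b)) :=
    fun n b hb => ENNReal.toReal_pos (convPow_Ici_ne_zero hb n) (measure_ne_top _ _)
  have hp0' : (0 : ℝ) < p n := by exact_mod_cast hp0
  have hq0' : (0 : ℝ) < q n := by exact_mod_cast hq0
  have hn0' : (0 : ℝ) < n := by exact_mod_cast hn0
  have key : Real.log ((convPow μ (p n)).real (Ici (p n * x))) +
      Real.log ((convPow μ (q n)).real (Ici (q n * y))) ≤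
      Real.log ((convPow μ n).real (Ici (n * z))) := by
    rw [← Real.log_mul (hpos _ hx).ne' (hpos _ hy).ne']
    refine Real.log_le_log (mul_pos (hpos _ hx) (hpos _ hy)) ?_
    rw [Measure.real, Measure.real, ← ENNReal.toReal_mul]
    refine ENNReal.toReal_mono (measure_ne_top _ _) ?_
    have hsum : p n + q n = n := Nat.add_sub_cancel' (hpn n)
    conv_rhs => rw [← hsum]
    refine convPow_Ici_mul_le μ ?_
    rw [hsum, hz, hq, show t = 1 - s by linarith]
    nlinarith [mul_nonneg (sub_nonneg.2 (hple n)) (sub_nonneg.2 hxy.le)]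
  simp only [Function.comp_apply]
  rw [div_mul_div_comm, div_mul_div_comm, mul_comm (n : ℝ) (p n), mul_comm (n : ℝ) (q n),
    mul_div_mul_left _ _ hp0'.ne', mul_div_mul_left _ _ hq0'.ne', ← add_div]
  gcongr
  linarith

lemma ConvexOn.exists_subgradient {D : Set ℝ} {f : ℝ → ℝ} (hf : ConvexOn ℝ D f) {a : ℝ}
    (ha : a ∈ interior D) : ∃ θ : ℝ, ∀ b ∈ D, f a + θ * (b - a) ≤ f b := by
  refine ⟨derivWithin f (Ioi a) a, fun b hb => ?_⟩
  rcases lt_trichotomy b a with hba | rfl | hab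
  · have h := (hf.slope_le_leftDeriv_of_mem_interior hb ha hba).trans
      (hf.leftDeriv_le_rightDeriv_of_mem_interior ha)
    rw [slope_def_field, div_le_iff₀ (sub_pos.2 hba)] at h
    linarith
  · simp
  · have h := hf.rightDeriv_le_slope_of_mem_interior ha hb hab
    rw [slope_def_field, le_div_iff₀ (sub_pos.2 hab)] at h
    linarith

/-- Below the essential supremum of `μ`, the decay rate of the upper tails is `κ*`. -/
lemma tendsto_neg_log_convPow_div_kappaStar {μ : Measure ℝ} [IsFiniteMeasure μ] {a b : ℝ}
    (hab : a < b) (hb : μ (Ici b) ≠ 0) :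
    ∃ L : ℝ, Tendsto (fun n : ℕ => -Real.log ((convPow μ n).real (Ici (n * a))) / n)
      atTop (𝓝 L) ∧ kappaStar μ a = L := by
  have hpos : ∀ (n : ℕ) {b : ℝ}, μ (Ici b) ≠ 0 → 0 < (convPow μ n).real (Ici (n * b)) :=
    fun n b hb => ENNReal.toReal_pos (convPow_Ici_ne_zero hb n) (measure_ne_top _ _)
  have hex : ∀ c : ℝ, ∃ L : ℝ, μ (Ici c) ≠ 0 →
      Tendsto (fun n : ℕ => -Real.log ((convPow μ n).real (Ici (n * c))) / n) atTop (𝓝 L) ∧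
      ∀ n : ℕ, n ≠ 0 → L ≤ -Real.log ((convPow μ n).real (Ici (n * c))) / n := by
    intro c
    by_cases hc : μ (Ici c) = 0
    · exact ⟨0, fun h => absurd hc h⟩
    · obtain ⟨L, hL⟩ := exists_tendsto_neg_log_convPow_div hc
      exact ⟨L, fun _ => hL⟩
  choose L hL using hex
  have hlow := isLowerSet_Ici_ne_zero μ
  have haD : μ (Ici a) ≠ 0 := hlow hab.le hb
  refine ⟨L a, (hL a haD).1, le_antisymm (iSup_le fun θ => ?_) ?_⟩
  · rcases lt_or_ge θ 0 with hθ | hθ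
    · simp [kappa, not_le.2 hθ]
    rw [kappa, if_pos hθ]
    set M := ∫⁻ z, ENNReal.ofReal (Real.exp (θ * z)) ∂μ
    rcases eq_or_ne M ⊤ with hMtop | hMtop
    · simp [hMtop]
    have hchern : ∀ n : ℕ, Real.exp (θ * (n * a)) * (convPow μ n).real (Ici (n * a)) ≤
        M.toReal ^ n := by
      intro n
      have h := ENNReal.toReal_mono (ENNReal.pow_ne_top hMtop)
        (exp_mul_convPow_Ici_le μ hθ n (n * a))
      rwa [ENNReal.toReal_mul, ENNReal.toReal_ofReal (Real.exp_pos _).le,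
        ENNReal.toReal_pow] at h
    have hMpos : 0 < M.toReal := by
      have h := (mul_pos (Real.exp_pos _) (hpos 1 haD)).trans_le (hchern 1)
      simpa using h
    rw [ENNReal.log_pos_real' hMpos, ← EReal.coe_sub, EReal.coe_le_coe_iff]
    refine ge_of_tendsto (hL a haD).1 ?_
    filter_upwards [eventually_gt_atTop 0] with n hn
    have hn' : (0 : ℝ) < n := by exact_mod_cast hn
    have h := Real.log_le_log (mul_pos (Real.exp_pos _) (hpos n haD)) (hchern n)
    rw [Real.log_mul (Real.exp_pos _).ne' (hpos n haD).ne', Real.log_exp, Real.log_pow] at h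
    rw [le_div_iff₀ hn']
    linarith
  · have hint : a ∈ interior {b : ℝ | μ (Ici b) ≠ 0} :=
      mem_interior.2 ⟨Iio b, fun c hc => hlow (le_of_lt hc) hb, isOpen_Iio, hab⟩
    obtain ⟨θ, hθ⟩ := (convexOn_rate fun c hc => (hL c hc).1).exists_subgradient hint
    have hθ0 : 0 ≤ θ := by
      have haD' : μ (Ici (a - 1)) ≠ 0 := hlow (sub_le_self a zero_le_one) haD
      have hle : L (a - 1) ≤ L a := by
        refine le_of_tendsto_of_tendsto' (hL _ haD').1 (hL a haD).1 fun n => ?_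
        have : (convPow μ n).real (Ici (n * a)) ≤ (convPow μ n).real (Ici (n * (a - 1))) :=
          measureReal_mono (Ici_subset_Ici.2
            (mul_le_mul_of_nonneg_left (by linarith) (Nat.cast_nonneg n)))
        gcongr
        exact hpos n haD
      linarith [hθ (a - 1) haD']
    have hMle : ∫⁻ z, ENNReal.ofReal (Real.exp (θ * z)) ∂μ ≤
        ENNReal.ofReal (Real.exp (θ * a - L a)) := by
      refine lintegral_exp_le_of_convPow_tail_le μ hθ0 (Real.exp_pos _) fun n hn y => ?_
      have hn' : (0 : ℝ) < n := by positivity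
      have hy : y = n * (y / n) := by field_simp
      by_cases hyD : μ (Ici (y / n)) = 0
      · rw [hy, convPow_Ici_eq_zero hyD hn]
        exact zero_le
      · rw [← ENNReal.ofReal_mul (by positivity), ← Real.exp_nat_mul, ← Real.exp_add,
          ENNReal.le_ofReal_iff_toReal_le (measure_ne_top _ _) (Real.exp_pos _).le]
        have hpy := hpos n hyD
        have h1 := (hL _ hyD).2 n hn
        have h2 := hθ _ hyD
        simp only [← hy, Measure.real] at h1 hpy
        rw [← Real.log_le_iff_le_exp hpy]
        have h3 := (le_div_iff₀ hn').1 (h2.trans h1)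
        have h4 : (L a + θ * (y / n - a)) * n = L a * n + θ * y - θ * a * n := by
          field_simp
          ring
        linarith
    refine le_trans ?_ (le_iSup (fun θ : ℝ => ((θ * a : ℝ) : EReal) - kappa μ θ) θ)
    rw [kappa, if_pos hθ0]
    have h := ENNReal.log_le_log hMle
    rw [ENNReal.log_ofReal_of_pos (Real.exp_pos _), Real.log_exp] at h
    calc ((L a : ℝ) : EReal) = ((θ * a : ℝ) : EReal) - ((θ * a - L a : ℝ) : EReal) := by
          rw [← EReal.coe_sub, sub_sub_cancel]
      _ ≤ _ := EReal.sub_le_sub le_rfl h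

/-- Above the essential supremum of `μ`, the Fenchel dual is infinite. -/
lemma kappaStar_eq_top {μ : Measure ℝ} [IsFiniteMeasure μ] {a b : ℝ} (hba : b < a)
    (hb : μ (Ici b) = 0) : kappaStar μ a = ⊤ := by
  rw [EReal.eq_top_iff_forall_lt]
  intro y
  set m : ℝ := μ.real univ + 1 with hm
  have hm0 : 0 < m := by positivity
  obtain ⟨θ, hθ0, hθ⟩ : ∃ θ : ℝ, 0 ≤ θ ∧ y < θ * (a - b) - Real.log m := by
    refine ⟨(|y| + |Real.log m| + 1) / (a - b), ?_, ?_⟩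
    · have := sub_pos.2 hba
      positivity
    · rw [div_mul_cancel₀ _ (sub_pos.2 hba).ne']
      linarith [le_abs_self y, le_abs_self (Real.log m)]
  have hae : ∀ᵐ z ∂μ, ENNReal.ofReal (Real.exp (θ * z)) ≤ ENNReal.ofReal (Real.exp (θ * b)) := by
    have : ∀ᵐ z ∂μ, z ∉ Ici b := measure_eq_zero_iff_ae_notMem.1 hb
    filter_upwards [this] with z hz
    exact ENNReal.ofReal_le_ofReal (Real.exp_le_exp.2
      (mul_le_mul_of_nonneg_left (not_le.1 hz).le hθ0))
  have hM : ∫⁻ z, ENNReal.ofReal (Real.exp (θ * z)) ∂μ ≤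
      ENNReal.ofReal (Real.exp (θ * b + Real.log m)) := by
    refine (lintegral_mono_ae hae).trans ?_
    rw [lintegral_const, Real.exp_add, Real.exp_log hm0, ENNReal.ofReal_mul (Real.exp_pos _).le]
    gcongr
    rw [ENNReal.le_ofReal_iff_toReal_le (measure_ne_top _ _) hm0.le, hm]
    exact (le_add_of_nonneg_right zero_le_one)
  refine lt_of_lt_of_le ?_ (le_iSup (fun θ : ℝ => ((θ * a : ℝ) : EReal) - kappa μ θ) θ)
  rw [kappa, if_pos hθ0]
  have h := ENNReal.log_le_log hM
  rw [ENNReal.log_ofReal_of_pos (Real.exp_pos _), Real.log_exp] at h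
  refine lt_of_lt_of_le ?_ (EReal.sub_le_sub le_rfl h)
  rw [← EReal.coe_sub, EReal.coe_lt_coe_iff]
  linarith

/-- Expected numbers in the branching random walk satisfy a large-deviation
limit with at most one exceptional point: there is `a₀ ∈ ℝ` such that for all
`a ≠ a₀`, `(1/n) log μ^{*n}([n a, ∞)) → −κ*(a)` in the extended reals. -/
theorem expected_numbers_limit (μ : Measure ℝ) [IsFiniteMeasure μ]
    (hμ : 1 < μ Set.univ)
    (hφ : ∃ φ : ℝ, 0 < φ ∧ kappa μ φ < ⊤) :
    ∃ a₀ : ℝ, ∀ a : ℝ, a ≠ a₀ →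
      Tendsto (fun n : ℕ =>
          ((((n : ℝ)⁻¹ : ℝ) : EReal)) * ((convPow μ n (Set.Ici ((n : ℝ) * a))).log))
        atTop (nhds (-(kappaStar μ a))) := by
  have hne : {b : ℝ | μ (Ici b) ≠ 0}.Nonempty := by
    by_contra! hempty
    have hnull : ∀ n : ℕ, μ (Ici (-n : ℝ)) = 0 := fun n => by
      by_contra hn
      exact (hempty ▸ notMem_empty (-n : ℝ)) hn
    have huniv : ⋃ n : ℕ, Ici (-n : ℝ) = univ := eq_univ_of_forall fun z => by
      obtain ⟨n, hn⟩ := exists_nat_ge (-z)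
      exact mem_iUnion.2 ⟨n, mem_Ici.2 (by linarith)⟩
    rw [← huniv, measure_iUnion_null hnull] at hμ
    exact not_lt_zero hμ
  refine ⟨sSup {b : ℝ | μ (Ici b) ≠ 0}, fun a ha => ?_⟩
  by_cases hex : ∃ b, a < b ∧ μ (Ici b) ≠ 0
  · obtain ⟨b, hab, hb⟩ := hex
    obtain ⟨L, hL, hκ⟩ := tendsto_neg_log_convPow_div_kappaStar hab hb
    rw [hκ, ← EReal.coe_neg]
    refine (EReal.tendsto_coe.2 hL.neg).congr fun n => ?_
    rw [ENNReal.log_pos_real (convPow_Ici_ne_zero (isLowerSet_Ici_ne_zero μ hab.le hb) n)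
      (measure_ne_top _ _), ← EReal.coe_mul, neg_div, neg_neg, div_eq_inv_mul]
    rfl
  · push Not at hex
    have hub : ∀ c ∈ {b : ℝ | μ (Ici b) ≠ 0}, c ≤ a := fun c hc =>
      not_lt.1 fun hac => hc (hex c hac)
    have hlt : sSup {b : ℝ | μ (Ici b) ≠ 0} < a := (csSup_le hne hub).lt_of_ne ha.symm
    obtain ⟨b, hb1, hb2⟩ := exists_between hlt
    have hb : μ (Ici b) = 0 := not_not.1 (notMem_of_csSup_lt hb1 ⟨a, hub⟩)
    have ha0 : μ (Ici a) = 0 := measure_mono_null (Ici_subset_Ici.2 hb2.le) hb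
    rw [kappaStar_eq_top hb2 hb, EReal.neg_top]
    refine tendsto_const_nhds.congr' ?_
    filter_upwards [eventually_gt_atTop 0] with n hn
    rw [convPow_Ici_eq_zero ha0 hn.ne', ENNReal.log_zero,
      EReal.coe_mul_bot_of_pos (by positivity)]
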